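/- arXiv:1910.01464 — 3 statements merged into one kernel-verified Lean document; each statement's English description precedes it below -/
import Mathlib

section
/- For every nonnegative integer ν, the stabilizer of I(F,ν) equals the stabilizer of its radical: stab(I(F,ν)) = stab(√(I(F,ν))). -/
open MvPolynomial Matrix

noncomputable section

/-- The `n × n` matrix of indeterminates `X = (X_{i,j})` over a field `K`. -/
def matX (K : Type) [Field K] (n : ℕ) :
    Matrix (Fin n) (Fin n) (MvPolynomial (Fin n × Fin n) K) :=
  Matrix.of fun i j => X (i, j)

/-- The ring `K[X, 1/det(X)]`. -/
abbrev GLRing (K : Type) [Field K] (n : ℕ) := Localization.Away (matX K n).det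

/-- The image of the matrix of indeterminates in `K[X, 1/det(X)]`. -/
def XX (K : Type) [Field K] (n : ℕ) : Matrix (Fin n) (Fin n) (GLRing K n) :=
  (matX K n).map (algebraMap _ _)

/-- The ideal `I(F,ν)` of `K[X,1/det(X)]` generated by the polynomials of total degree
at most `ν` vanishing at the fundamental matrix (encoded by the evaluation map `ev`). -/
def Ifv {K : Type} [Field K] {n : ℕ} {S : Type} [CommRing S]
    (ev : GLRing K n → S) (ν : ℕ) : Ideal (GLRing K n) :=
  Ideal.span {q | ∃ P : MvPolynomial (Fin n × Fin n) K, P.totalDegree ≤ ν ∧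
    ev (algebraMap (MvPolynomial (Fin n × Fin n) K) (GLRing K n) P) = 0 ∧
    q = algebraMap (MvPolynomial (Fin n × Fin n) K) (GLRing K n) P}

/-- The stabilizer `stab(I) = {g : ∀ P ∈ I, P(Xg) ∈ I}` of an ideal `I`, where
`σ g` is the substitution `P(X) ↦ P(Xg)`. -/
def stab {G R : Type} [CommRing R] (σ : G → R → R) (I : Ideal R) : Set G :=
  {g | ∀ P ∈ I, σ g P ∈ I}

/-- If `x ^ a * (D x) ^ b = 0` in an algebra over a field of characteristic zero, then the
derivative `D x` is nilpotent. -/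
theorem Derivation.isNilpotent_of_pow_mul_pow_eq_zero {C S : Type*} [Field C] [CharZero C]
    [CommRing S] [Algebra C S] (D : Derivation C S S) (x : S) (a b : ℕ)
    (h : x ^ a * D x ^ b = 0) : IsNilpotent (D x) := by
  induction a generalizing b with
  | zero => exact ⟨b, by simpa using h⟩
  | succ a ih =>
    apply ih (b + 2)
    have hD : D (x ^ (a + 1) * D x ^ b) * D x = 0 := by rw [h]; simp
    have hb : (b : S) * D x ^ (b - 1) * D x = b * D x ^ b := by
      cases b with
      | zero => simp
      | succ b => simp [pow_succ, mul_assoc]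
    rw [D.leibniz, D.leibniz_pow, D.leibniz_pow] at hD
    simp only [smul_eq_mul, nsmul_eq_mul, Nat.add_sub_cancel] at hD
    have key : ((a + 1 : ℕ) : S) * (x ^ a * D x ^ (b + 2)) = 0 := by
      linear_combination hD - x ^ (a + 1) * D (D x) * hb - b * D (D x) * h
    have hu : IsUnit ((a + 1 : ℕ) : S) := by
      have := (IsUnit.mk0 ((a + 1 : ℕ) : C) (Nat.cast_ne_zero.mpr a.succ_ne_zero)).map
        (algebraMap C S)
      simpa using this
    exact hu.mul_right_eq_zero.mp key

/-- A differentially simple algebra over a field of characteristic zero is reduced. -/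
theorem Derivation.isReduced_of_simple {C S : Type*} [Field C] [CharZero C]
    [CommRing S] [Nontrivial S] [Algebra C S] (D : Derivation C S S)
    (hsimple : ∀ J : Ideal S, J ≠ ⊤ → (∀ x ∈ J, D x ∈ J) → J = ⊥) : IsReduced S := by
  rw [← nilradical_eq_bot_iff]
  refine hsimple _ ?_ ?_
  · rw [Ne, Ideal.eq_top_iff_one, mem_nilradical]
    exact not_isNilpotent_one
  · intro x hx
    obtain ⟨a, ha⟩ := mem_nilradical.mp hx
    exact mem_nilradical.mpr (D.isNilpotent_of_pow_mul_pow_eq_zero x a 0 (by simpa using ha))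

/-- Substituting polynomials of degree at most one does not raise the total degree. -/
theorem MvPolynomial.totalDegree_aeval_le_of_le_one {σ τ K : Type*} [CommRing K]
    (f : σ → MvPolynomial τ K) (hf : ∀ i, (f i).totalDegree ≤ 1) (P : MvPolynomial σ K) :
    (aeval f P).totalDegree ≤ P.totalDegree := by
  rw [aeval_def, eval₂_eq]
  refine totalDegree_finsetSum_le fun d hd => ?_
  refine (totalDegree_mul _ _).trans ?_
  rw [algebraMap_eq, totalDegree_C, zero_add]
  refine (totalDegree_finsetProd _ _).trans (le_trans ?_ (le_totalDegree hd))
  refine Finset.sum_le_sum fun i _ => (totalDegree_pow _ _).trans ?_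
  simpa using Nat.mul_le_mul_left (d i) (hf i)

/-- The substitution `X ↦ Xg` on polynomials. -/
def mulRightSubst {K : Type} [Field K] {n : ℕ} (M : Matrix (Fin n) (Fin n) K) :
    MvPolynomial (Fin n × Fin n) K →ₐ[K] MvPolynomial (Fin n × Fin n) K :=
  aeval fun p => ∑ l, X (p.1, l) * C (M l p.2)

theorem totalDegree_mulRightSubst_le {K : Type} [Field K] {n : ℕ}
    (M : Matrix (Fin n) (Fin n) K) (P : MvPolynomial (Fin n × Fin n) K) :
    (mulRightSubst M P).totalDegree ≤ P.totalDegree := by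
  refine totalDegree_aeval_le_of_le_one _ (fun p => ?_) P
  refine totalDegree_finsetSum_le fun l _ => (totalDegree_mul _ _).trans ?_
  rw [totalDegree_C, totalDegree_X]

theorem statement3
    (C : Type) [Field C] [IsAlgClosed C] [CharZero C]
    (n : ℕ)
    -- the derivation δ = d/dt on k = C(t)
    (dk : Derivation C (RatFunc C) (RatFunc C)) (hdk : dk RatFunc.X = 1)
    (A : Matrix (Fin n) (Fin n) (RatFunc C))
    -- the derivation on k[X,1/det(X)] extending δ with δ(X) = AX
    (dR : Derivation C (GLRing (RatFunc C) n) (GLRing (RatFunc C) n))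
    (hdRk : ∀ a : RatFunc C, dR (algebraMap (RatFunc C) (GLRing (RatFunc C) n) a)
      = algebraMap (RatFunc C) (GLRing (RatFunc C) n) (dk a))
    (hdRX : ∀ i j, dR (XX (RatFunc C) n i j)
      = (A.map (algebraMap (RatFunc C) (GLRing (RatFunc C) n)) * XX (RatFunc C) n) i j)
    -- the Picard-Vessiot ring S of δ(Y) = AY over k, with fundamental matrix F
    (S : Type) [CommRing S] [Nontrivial S] [Algebra (RatFunc C) S] [Algebra C S]
    [IsScalarTower C (RatFunc C) S]
    (dS : Derivation C S S)
    (hdSk : ∀ a : RatFunc C, dS (algebraMap (RatFunc C) S a) = algebraMap (RatFunc C) S (dk a))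
    (F : Matrix (Fin n) (Fin n) S) (hF : IsUnit F.det)
    (hdF : ∀ i j, dS (F i j) = (A.map (algebraMap (RatFunc C) S) * F) i j)
    -- evaluation P(X) ↦ P(F)
    (ev : GLRing (RatFunc C) n →ₐ[RatFunc C] S)
    (hev : ∀ i j, ev (XX (RatFunc C) n i j) = F i j)
    (hevsurj : Function.Surjective ev)      -- S is generated by the entries of F and 1/det(F)
    (hsimple : ∀ J : Ideal S, J ≠ ⊤ → (∀ x ∈ J, dS x ∈ J) → J = ⊥)  -- S is δ-simple
    (hconst : ∀ s : S, dS s = 0 → ∃ c : C, s = algebraMap C S c)   -- constants of S are C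
    -- the substitution maps P(X) ↦ P(Xg) for g ∈ GL_n(C)
    (subst : GL (Fin n) C → (GLRing (RatFunc C) n →ₐ[RatFunc C] GLRing (RatFunc C) n))
    (hsubst : ∀ (g : GL (Fin n) C) i j, subst g (XX (RatFunc C) n i j)
      = ∑ l, XX (RatFunc C) n i l *
          algebraMap C (GLRing (RatFunc C) n) ((g : Matrix (Fin n) (Fin n) C) l j))
    (ν : ℕ) :
    stab (fun g => (subst g : GLRing (RatFunc C) n → GLRing (RatFunc C) n)) (Ifv (⇑ev) ν)
      = stab (fun g => (subst g : GLRing (RatFunc C) n → GLRing (RatFunc C) n))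
          (Ifv (⇑ev) ν).radical := by
  have hred : IsReduced S := dS.isReduced_of_simple hsimple
  have hker : (Ifv (⇑ev) ν).radical ≤ RingHom.ker ev := by
    refine Ideal.IsRadical.radical_le_iff (RingHom.ker_isRadical_iff_reduced_of_surjective
      hevsurj |>.mpr hred) |>.mpr (Ideal.span_le.mpr ?_)
    rintro _ ⟨P, -, hP, rfl⟩
    exact hP
  have hpoly (g : GL (Fin n) C) (P : MvPolynomial (Fin n × Fin n) (RatFunc C)) :
      subst g (algebraMap _ (GLRing (RatFunc C) n) P) = algebraMap _ (GLRing (RatFunc C) n)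
        (mulRightSubst ((g : Matrix (Fin n) (Fin n) C).map (algebraMap C (RatFunc C))) P) := by
    have h : (subst g).comp (IsScalarTower.toAlgHom (RatFunc C) _ (GLRing (RatFunc C) n)) =
        (IsScalarTower.toAlgHom (RatFunc C) _ (GLRing (RatFunc C) n)).comp (mulRightSubst
          ((g : Matrix (Fin n) (Fin n) C).map (algebraMap C (RatFunc C)))) := by
      refine MvPolynomial.algHom_ext fun p => ?_
      have := hsubst g p.1 p.2
      simp only [XX, matX, Matrix.map_apply, Matrix.of_apply] at this
      simp only [AlgHom.comp_apply, IsScalarTower.coe_toAlgHom', mulRightSubst, aeval_X, this,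
        map_sum, map_mul, Matrix.map_apply]
      refine Finset.sum_congr rfl fun l _ => ?_
      congr 1
    exact DFunLike.congr_fun h P
  ext g
  constructor
  · rintro hg P ⟨m, hm⟩
    exact ⟨m, by simpa using hg _ hm⟩
  · intro hg
    change Ifv (⇑ev) ν ≤ (Ifv (⇑ev) ν).comap (subst g)
    refine Ideal.span_le.mpr ?_
    rintro _ ⟨P, hdeg, hP, rfl⟩
    have hmem := hker (hg _ (Ideal.le_radical (Ideal.subset_span ⟨P, hdeg, hP, rfl⟩)))
    simp only [hpoly] at hmem
    exact Ideal.subset_span ⟨_, (totalDegree_mulRightSubst_le _ P).trans hdeg, hmem, hpoly g P⟩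
end
end

section
/- For every nonnegative integer ν, the variety V_{k̄}(I(F,ν)) of zeros of I(F,ν) in GL_n(k̄) is an H-torsor over k, where H = stab(I(F,ν)); that is, V_{k̄}(I(F,ν)) = α · H(k̄) for some (equivalently, every) α ∈ V_{k̄}(I(F,ν)). -/
open MvPolynomial Matrix

noncomputable section

/-- The `K`-points of a subset `H` of `GL_n(C)`: the invertible matrices over `K`
satisfying every polynomial equation (with coefficients in `C`) satisfied by all of `H`. -/
def pts (C : Type) [Field C] (K : Type) [Field K] [Algebra C K] (n : ℕ)
    (H : Set (GL (Fin n) C)) : Set (GL (Fin n) K) :=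
  {M | ∀ P : MvPolynomial (Fin n × Fin n) C,
    (∀ h ∈ H, MvPolynomial.eval (fun p => (h : Matrix (Fin n) (Fin n) C) p.1 p.2) P = 0) →
    MvPolynomial.aeval (fun p => (M : Matrix (Fin n) (Fin n) K) p.1 p.2) P = 0}

/-- The zero set `V_K(I)` of an ideal `I` of `k[X,1/det(X)]` inside `GL_n(K)`, where
`evK M` is evaluation `P(X) ↦ P(M)`. -/
def zeroSet {k K : Type} [Field k] [Field K] {n : ℕ}
    (evK : GL (Fin n) K → (GLRing k n → K)) (I : Ideal (GLRing k n)) :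
    Set (GL (Fin n) K) :=
  {M | ∀ P ∈ I, evK M P = 0}

section MatrixSubstitution

variable {n : ℕ} {R L T : Type*} [CommRing R] [CommRing L] [CommRing T]

/-- Evaluation of a polynomial in matrix entries at the matrix `N`, along `φ` on coefficients. -/
def evalMat (φ : R →+* L) (N : Matrix (Fin n) (Fin n) L) :
    MvPolynomial (Fin n × Fin n) R →+* L :=
  eval₂Hom φ fun p => N p.1 p.2

/-- The substitution `P(X) ↦ P(MX)`. -/
def leftMul (M : Matrix (Fin n) (Fin n) R) :
    MvPolynomial (Fin n × Fin n) R →ₐ[R] MvPolynomial (Fin n × Fin n) R :=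
  aeval fun p => ∑ l, MvPolynomial.C (M p.1 l) * X (l, p.2)

/-- The substitution `P(X) ↦ P(XM)`. -/
def rightMul (M : Matrix (Fin n) (Fin n) R) :
    MvPolynomial (Fin n × Fin n) R →ₐ[R] MvPolynomial (Fin n × Fin n) R :=
  aeval fun p => ∑ l, X (p.1, l) * MvPolynomial.C (M l p.2)

@[simp]
theorem evalMat_C (φ : R →+* L) (N : Matrix (Fin n) (Fin n) L) (a : R) :
    evalMat φ N (MvPolynomial.C a) = φ a := by
  simp [evalMat]

@[simp]
theorem evalMat_X (φ : R →+* L) (N : Matrix (Fin n) (Fin n) L) (p : Fin n × Fin n) :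
    evalMat φ N (X p) = N p.1 p.2 := by
  simp [evalMat]

@[simp]
theorem leftMul_X (M : Matrix (Fin n) (Fin n) R) (p : Fin n × Fin n) :
    leftMul M (X p) = ∑ l, MvPolynomial.C (M p.1 l) * X (l, p.2) := by
  simp [leftMul]

@[simp]
theorem rightMul_X (M : Matrix (Fin n) (Fin n) R) (p : Fin n × Fin n) :
    rightMul M (X p) = ∑ l, X (p.1, l) * MvPolynomial.C (M l p.2) := by
  simp [rightMul]

@[simp]
theorem leftMul_C (M : Matrix (Fin n) (Fin n) R) (a : R) :
    leftMul M (MvPolynomial.C a) = MvPolynomial.C a := by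
  simp [leftMul]

@[simp]
theorem rightMul_C (M : Matrix (Fin n) (Fin n) R) (a : R) :
    rightMul M (MvPolynomial.C a) = MvPolynomial.C a := by
  simp [rightMul]

theorem evalMat_leftMul (φ : R →+* L) (N : Matrix (Fin n) (Fin n) L)
    (M : Matrix (Fin n) (Fin n) R) (P : MvPolynomial (Fin n × Fin n) R) :
    evalMat φ N (leftMul M P) = evalMat φ (M.map φ * N) P := by
  induction P using MvPolynomial.induction_on with
  | C a => simp
  | add p q hp hq => simp [hp, hq]
  | mul_X p i hp => simp [hp, Matrix.mul_apply]

theorem evalMat_rightMul (φ : R →+* L) (N : Matrix (Fin n) (Fin n) L)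
    (M : Matrix (Fin n) (Fin n) R) (P : MvPolynomial (Fin n × Fin n) R) :
    evalMat φ N (rightMul M P) = evalMat φ (N * M.map φ) P := by
  induction P using MvPolynomial.induction_on with
  | C a => simp
  | add p q hp hq => simp [hp, hq]
  | mul_X p i hp => simp [hp, Matrix.mul_apply]

theorem evalMat_map (φ : R →+* L) (ψ : T →+* R) (N : Matrix (Fin n) (Fin n) L)
    (P : MvPolynomial (Fin n × Fin n) T) :
    evalMat φ N (MvPolynomial.map ψ P) = evalMat (φ.comp ψ) N P := by
  simp [evalMat]

theorem map_evalMat (φ : R →+* L) (ψ : T →+* R) (N : Matrix (Fin n) (Fin n) R)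
    (P : MvPolynomial (Fin n × Fin n) T) :
    φ (evalMat ψ N P) = evalMat (φ.comp ψ) (N.map φ) P := by
  induction P using MvPolynomial.induction_on with
  | C a => simp
  | add p q hp hq => simp [hp, hq]
  | mul_X p i hp => simp [hp]

theorem leftMul_mul (M N : Matrix (Fin n) (Fin n) R) (P : MvPolynomial (Fin n × Fin n) R) :
    leftMul N (leftMul M P) = leftMul (M * N) P := by
  induction P using MvPolynomial.induction_on with
  | C a => simp
  | add p q hp hq => simp [hp, hq]
  | mul_X p i hp =>
    simp only [map_mul, hp, leftMul_X, map_sum, leftMul_C, Matrix.mul_apply, Finset.sum_mul,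
      Finset.mul_sum]
    rw [Finset.sum_comm]
    simp only [mul_assoc]

theorem leftMul_one (P : MvPolynomial (Fin n × Fin n) R) : leftMul 1 P = P := by
  induction P using MvPolynomial.induction_on with
  | C a => simp
  | add p q hp hq => simp [hp, hq]
  | mul_X p i hp => simp [hp, Matrix.one_apply]

end MatrixSubstitution

section Degree

variable {σ K : Type*} [CommRing K]

theorem totalDegree_addMonoidHom_le
    (f : MvPolynomial σ K →+ MvPolynomial σ K)
    (hf : ∀ s a, (f (monomial s a)).totalDegree ≤ s.degree) (P : MvPolynomial σ K) :
    (f P).totalDegree ≤ P.totalDegree := by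
  conv_lhs => rw [P.as_sum, map_sum]
  refine totalDegree_finsetSum_le fun s hs => (hf s _).trans ?_
  exact le_totalDegree hs

theorem totalDegree_aeval_le (g : σ → MvPolynomial σ K) (hg : ∀ i, (g i).totalDegree ≤ 1)
    (P : MvPolynomial σ K) : (aeval g P).totalDegree ≤ P.totalDegree := by
  refine totalDegree_addMonoidHom_le (aeval g : _ →ₐ[K] MvPolynomial σ K).toAddMonoidHom ?_ P
  intro s a
  change (aeval g (monomial s a)).totalDegree ≤ _
  rw [aeval_monomial, algebraMap_eq]
  refine (totalDegree_mul _ _).trans ?_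
  rw [totalDegree_C, zero_add]
  refine (totalDegree_finsetProd _ _).trans (Finset.sum_le_sum fun i _ => ?_)
  exact (totalDegree_pow _ _).trans ((Nat.mul_le_mul_left _ (hg i)).trans (mul_one _).le)

theorem totalDegree_mkDerivation_le (g : σ → MvPolynomial σ K)
    (hg : ∀ i, (g i).totalDegree ≤ 1) (P : MvPolynomial σ K) :
    (mkDerivation K g P).totalDegree ≤ P.totalDegree := by
  refine totalDegree_addMonoidHom_le
    (mkDerivation K g : Derivation K _ _).toLinearMap.toAddMonoidHom ?_ P
  intro s a
  change (mkDerivation K g (monomial s a)).totalDegree ≤ _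
  rw [mkDerivation_monomial]
  refine (totalDegree_smul_le _ _).trans (totalDegree_finsetSum_le fun i hi => ?_)
  refine (totalDegree_mul _ _).trans ((add_le_add (totalDegree_monomial_le _ _) (hg i)).trans ?_)
  have h1 : Finsupp.single i 1 ≤ s := by
    rw [Finsupp.single_le_iff]
    exact Nat.one_le_iff_ne_zero.mpr (Finsupp.mem_support_iff.mp hi)
  have h2 : (s - Finsupp.single i 1).degree + 1 = s.degree := by
    conv_rhs => rw [← tsub_add_cancel_of_le h1, map_add, Finsupp.degree_single]
  exact h2.le

theorem totalDegree_rightMul_le {n : ℕ} (M : Matrix (Fin n) (Fin n) K)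
    (P : MvPolynomial (Fin n × Fin n) K) : (rightMul M P).totalDegree ≤ P.totalDegree := by
  refine totalDegree_aeval_le _ (fun p => totalDegree_finsetSum_le fun l _ => ?_) P
  refine (totalDegree_mul _ _).trans ?_
  rw [totalDegree_C, add_zero]
  exact (totalDegree_monomial_le _ _).trans (by simp)

end Degree

section CoefficientwiseDerivation

variable {C R σ : Type*} [CommRing C] [CommRing R] [Algebra C R]

/-- The action of a derivation on the coefficients of polynomials. -/
def coeffDer (d : Derivation C R R) : MvPolynomial σ R →+ MvPolynomial σ R where
  toFun P := AddMonoidAlgebra.map (d : R →+ R) P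
  map_zero' := by ext; simp [MvPolynomial.coeff]
  map_add' p q := by ext; simp [MvPolynomial.coeff]

@[simp]
theorem coeff_coeffDer (d : Derivation C R R) (P : MvPolynomial σ R) (m : σ →₀ ℕ) :
    MvPolynomial.coeff m (coeffDer d P) = d (MvPolynomial.coeff m P) :=
  rfl

theorem coeffDer_monomial (d : Derivation C R R) (m : σ →₀ ℕ) (a : R) :
    coeffDer d (monomial m a) = monomial m (d a) := by
  classical
  ext s
  rw [coeff_coeffDer, coeff_monomial, coeff_monomial]
  split_ifs <;> simp

@[simp]
theorem coeffDer_C (d : Derivation C R R) (a : R) :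
    coeffDer d (MvPolynomial.C a : MvPolynomial σ R) = MvPolynomial.C (d a) :=
  coeffDer_monomial d 0 a

@[simp]
theorem coeffDer_X (d : Derivation C R R) (i : σ) :
    coeffDer d (X i : MvPolynomial σ R) = 0 := by
  rw [X, coeffDer_monomial]; simp

theorem coeffDer_mul (d : Derivation C R R) (P Q : MvPolynomial σ R) :
    coeffDer d (P * Q) = P * coeffDer d Q + Q * coeffDer d P := by
  induction P using MvPolynomial.induction_on' with
  | add p q hp hq => rw [add_mul, map_add, hp, hq, map_add]; ring
  | monomial u a =>
    induction Q using MvPolynomial.induction_on' with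
    | add p q hp hq => rw [mul_add, map_add, hp, hq, map_add]; ring
    | monomial v b =>
      simp only [monomial_mul, coeffDer_monomial, Derivation.leibniz, smul_eq_mul, map_add]
      rw [add_comm v u]

theorem coeffDer_smul (d : Derivation C R R) (a : R) (P : MvPolynomial σ R) :
    coeffDer d (a • P) = a • coeffDer d P + d a • P := by
  ext m; simp [mul_comm]

theorem totalDegree_coeffDer_le (d : Derivation C R R) (P : MvPolynomial σ R) :
    (coeffDer d P).totalDegree ≤ P.totalDegree :=
  totalDegree_addMonoidHom_le _
    (fun s a => by rw [coeffDer_monomial]; exact totalDegree_monomial_le _ _) P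

end CoefficientwiseDerivation

section DifferentialDescent

variable {C S σ : Type*} [CommRing C] [CommRing S] [Algebra C S]

theorem exists_constant_mem (d : Derivation C S S)
    (hsimple : ∀ J : Ideal S, J ≠ ⊤ → (∀ x ∈ J, d x ∈ J) → J = ⊥)
    (M : Submodule S (MvPolynomial σ S)) (hM : ∀ f ∈ M, coeffDer d f ∈ M)
    (T : Finset (σ →₀ ℕ)) (hT : ∃ f ∈ M, f ≠ 0 ∧ f.support ⊆ T) :
    ∃ g ∈ M, coeffDer d g = 0 ∧ g.support ⊆ T ∧ ∃ z ∈ T, MvPolynomial.coeff z g = 1 := by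
  classical
  induction T using Finset.strongInduction with
  | H T ih =>
    obtain ⟨f, hfM, hf0, hfT⟩ := hT
    obtain ⟨z, hz⟩ := MvPolynomial.support_nonempty.mpr hf0
    let J : Ideal S :=
      { carrier := {s | ∃ g ∈ M, g.support ⊆ T ∧ MvPolynomial.coeff z g = s}
        zero_mem' := ⟨0, M.zero_mem, by simp, by simp⟩
        add_mem' := by
          rintro _ _ ⟨g, hg, hgT, rfl⟩ ⟨h, hh, hhT, rfl⟩
          exact ⟨g + h, M.add_mem hg hh,
            MvPolynomial.support_add.trans (Finset.union_subset hgT hhT), by simp⟩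
        smul_mem' := by
          rintro s _ ⟨g, hg, hgT, rfl⟩
          exact ⟨s • g, M.smul_mem s hg, MvPolynomial.support_smul.trans hgT, by simp⟩ }
    have hsupp : ∀ g : MvPolynomial σ S, (coeffDer d g).support ⊆ g.support := by
      intro g m hm
      rw [MvPolynomial.mem_support_iff, coeff_coeffDer] at hm
      rw [MvPolynomial.mem_support_iff]
      intro h
      exact hm (by rw [h, map_zero])
    have hJ : J = ⊤ := by
      by_contra hne
      have hbot := hsimple J hne (by
        rintro _ ⟨g, hg, hgT, rfl⟩
        exact ⟨coeffDer d g, hM g hg, (hsupp g).trans hgT, by simp⟩)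
      have : MvPolynomial.coeff z f ∈ J := ⟨f, hfM, hfT, rfl⟩
      rw [hbot, Ideal.mem_bot] at this
      exact (MvPolynomial.mem_support_iff.mp hz) this
    obtain ⟨g, hg, hgT, hgz⟩ : (1 : S) ∈ J := by rw [hJ]; trivial
    by_cases hdg : coeffDer d g = 0
    · exact ⟨g, hg, hdg, hgT, z, hfT hz, hgz⟩
    · obtain ⟨g', hg', hd', hT', w, hw, hw'⟩ := ih (T.erase z) (Finset.erase_ssubset (hfT hz))
        ⟨coeffDer d g, hM g hg, hdg, by
          refine Finset.subset_erase.mpr ⟨(hsupp g).trans hgT, ?_⟩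
          rw [MvPolynomial.notMem_support_iff, coeff_coeffDer, hgz]
          exact d.map_one_eq_zero⟩
      exact ⟨g', hg', hd', hT'.trans (Finset.erase_subset _ _), w, Finset.mem_of_mem_erase hw, hw'⟩

/-- A differential submodule of a polynomial module with coefficients in a differentially simple
ring is spanned by its constants. -/
theorem le_span_constants (d : Derivation C S S)
    (hsimple : ∀ J : Ideal S, J ≠ ⊤ → (∀ x ∈ J, d x ∈ J) → J = ⊥)
    (M : Submodule S (MvPolynomial σ S)) (hM : ∀ f ∈ M, coeffDer d f ∈ M) :
    M ≤ Submodule.span S {g | g ∈ M ∧ coeffDer d g = 0} := by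
  classical
  suffices H : ∀ (T : Finset (σ →₀ ℕ)), ∀ f ∈ M, f.support ⊆ T →
      f ∈ Submodule.span S {g | g ∈ M ∧ coeffDer d g = 0} from
    fun f hf => H f.support f hf subset_rfl
  intro T
  induction T using Finset.strongInduction with
  | H T ih =>
    intro f hf hfT
    by_cases hf0 : f = 0
    · rw [hf0]; exact Submodule.zero_mem _
    obtain ⟨g, hg, hdg, hgT, z, hz, hgz⟩ := exists_constant_mem d hsimple M hM T ⟨f, hf, hf0, hfT⟩
    have hgspan : MvPolynomial.coeff z f • g ∈
        Submodule.span S {g | g ∈ M ∧ coeffDer d g = 0} :=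
      Submodule.smul_mem _ _ (Submodule.subset_span ⟨hg, hdg⟩)
    have hrest := ih (T.erase z) (Finset.erase_ssubset hz) (f - MvPolynomial.coeff z f • g)
      (M.sub_mem hf (M.smul_mem _ hg)) (by
        refine Finset.subset_erase.mpr ⟨?_, ?_⟩
        · refine (MvPolynomial.support_sub _ _ _).trans (Finset.union_subset hfT ?_)
          exact MvPolynomial.support_smul.trans hgT
        · simp [hgz])
    have := Submodule.add_mem _ hrest hgspan
    rwa [sub_add_cancel] at this

end DifferentialDescent

section Points

variable {C K : Type} [Field C] [Field K] [Algebra C K] {n : ℕ}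

theorem mem_pts_iff {H : Set (GL (Fin n) C)} {M : GL (Fin n) K} :
    M ∈ pts C K n H ↔ ∀ P : MvPolynomial (Fin n × Fin n) C,
      (∀ h ∈ H, evalMat (RingHom.id C) h.val P = 0) → evalMat (algebraMap C K) M.val P = 0 :=
  Iff.rfl

/-- A polynomial over an extension field vanishing on `H` vanishes on the points of `H`. -/
theorem evalMat_eq_zero_of_mem_pts {H : Set (GL (Fin n) C)} {M : GL (Fin n) K}
    (hM : M ∈ pts C K n H) (P : MvPolynomial (Fin n × Fin n) K)
    (hP : ∀ h ∈ H, evalMat (RingHom.id K) (h.val.map (algebraMap C K)) P = 0) :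
    evalMat (RingHom.id K) M.val P = 0 := by
  let b := Module.Basis.ofVectorSpace C K
  let Q : _ → MvPolynomial (Fin n × Fin n) C := fun i =>
    ∑ m ∈ P.support, monomial m (b.repr (MvPolynomial.coeff m P) i)
  have key : ∀ (N : Matrix (Fin n) (Fin n) K),
      evalMat (RingHom.id K) N P =
        ∑ m ∈ P.support, MvPolynomial.coeff m P * m.prod fun p e => N p.1 p.2 ^ e := by
    intro N
    simp [evalMat, eval₂_eq, Finsupp.prod]
  have hQ : ∀ i, ∀ h ∈ H, evalMat (RingHom.id C) h.val (Q i) = 0 := by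
    intro i h hh
    have h0 := congrArg (fun x => b.repr x i) (hP h hh)
    rw [key] at h0
    have hprod : ∀ m : (Fin n × Fin n) →₀ ℕ,
        (m.prod fun p e => (h.val.map (algebraMap C K)) p.1 p.2 ^ e) =
          algebraMap C K (m.prod fun p e => h.val p.1 p.2 ^ e) := by
      intro m
      simp [Finsupp.prod, map_prod]
    simp only [hprod, mul_comm _ (algebraMap C K _), ← Algebra.smul_def, map_sum, map_smul,
      Finsupp.coe_finsetSum, Finset.sum_apply, Finsupp.smul_apply, smul_eq_mul, map_zero,
      Finsupp.coe_zero, Pi.zero_apply] at h0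
    simp only [Q, map_sum, evalMat, coe_eval₂Hom, eval₂_monomial, RingHom.id_apply]
    simpa only [mul_comm] using h0
  have hQM : ∀ i, ∑ m ∈ P.support, algebraMap C K (b.repr (MvPolynomial.coeff m P) i) *
      (m.prod fun p e => M.val p.1 p.2 ^ e) = 0 := by
    intro i
    have := mem_pts_iff.mp hM (Q i) (hQ i)
    simpa only [Q, map_sum, evalMat, coe_eval₂Hom, eval₂_monomial] using this
  classical
  let U := P.support.biUnion fun m => (b.repr (MvPolynomial.coeff m P)).support
  have hexp : ∀ m ∈ P.support, MvPolynomial.coeff m P =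
      ∑ i ∈ U, algebraMap C K (b.repr (MvPolynomial.coeff m P) i) * b i := by
    intro m hm
    conv_lhs => rw [← b.linearCombination_repr (MvPolynomial.coeff m P)]
    rw [Finsupp.linearCombination_apply, Finsupp.sum_of_support_subset _ (s := U)]
    · simp only [Algebra.smul_def]
    · exact Finset.subset_biUnion_of_mem
        (fun m => (b.repr (MvPolynomial.coeff m P)).support) hm
    · simp
  rw [key, Finset.sum_congr rfl fun m hm => by rw [hexp m hm, Finset.sum_mul], Finset.sum_comm]
  refine Finset.sum_eq_zero fun i _ => ?_
  have := congrArg (b i * ·) (hQM i)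
  simp only [Finset.mul_sum, mul_zero] at this
  rw [← this]
  exact Finset.sum_congr rfl fun m _ => by ring

theorem Ideal.mem_of_apply_mem_of_surjective {R : Type*} [CommRing R] [IsNoetherianRing R]
    (I : Ideal R) (f : R →+* R) (hf : Function.Surjective f) (hI : I ≤ I.comap f) {x : R}
    (hx : f x ∈ I) : x ∈ I := by
  have hmono : Monotone fun m : ℕ => (Ideal.comap f)^[m] I :=
    monotone_nat_of_le_succ fun m => by
      simp only [Function.iterate_succ, Function.comp_apply]
      exact (Monotone.iterate (fun _ _ h => Ideal.comap_mono h) m) hI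
  obtain ⟨m, hm⟩ := monotone_stabilizes_iff_noetherian.mpr ‹IsNoetherianRing R› ⟨_, hmono⟩
  have heq : (Ideal.comap f)^[m] I = (Ideal.comap f)^[m] (I.comap f) := by
    have h := hm (m + 1) m.le_succ
    simpa only [OrderHom.coe_mk, Function.iterate_succ, Function.comp_apply] using h
  rw [((Ideal.comap_injective_of_surjective f hf).iterate m) heq]
  exact hx

/-- The points of a subset of `GL_n(C)` closed under multiplication are closed under division. -/
theorem inv_mul_mem_pts {H : Set (GL (Fin n) C)} (hmul : ∀ g ∈ H, ∀ h ∈ H, g * h ∈ H)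
    {a b : GL (Fin n) K} (ha : a ∈ pts C K n H) (hb : b ∈ pts C K n H) :
    a⁻¹ * b ∈ pts C K n H := by
  let I : Ideal (MvPolynomial (Fin n × Fin n) K) :=
    ⨅ h ∈ H, RingHom.ker (evalMat (RingHom.id K) (h.val.map (algebraMap C K)))
  have hI : ∀ P, P ∈ I ↔
      ∀ h ∈ H, evalMat (RingHom.id K) (h.val.map (algebraMap C K)) P = 0 := by
    intro P
    simp [I, RingHom.mem_ker]
  have hinv : ∀ P : MvPolynomial (Fin n × Fin n) K, leftMul a.val (leftMul a⁻¹.val P) = P := by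
    intro P
    rw [leftMul_mul, ← Units.val_mul, inv_mul_cancel, Units.val_one, leftMul_one]
  have hle : I ≤ I.comap (leftMul a.val).toRingHom := by
    intro P hP
    rw [hI] at hP
    rw [Ideal.mem_comap, hI]
    intro h hh
    change evalMat _ _ (leftMul a.val P) = 0
    have hr := evalMat_eq_zero_of_mem_pts ha (rightMul (h.val.map (algebraMap C K)) P) (by
      intro g hg
      have := hP (g * h) (hmul g hg h hh)
      rw [evalMat_rightMul]
      simpa [Matrix.map_mul] using this)
    rw [evalMat_rightMul] at hr
    rw [evalMat_leftMul]
    simpa using hr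
  rw [mem_pts_iff]
  intro Q hQ
  have hQI : (leftMul a.val).toRingHom
      (leftMul a⁻¹.val (MvPolynomial.map (algebraMap C K) Q)) ∈ I := by
    change leftMul a.val _ ∈ I
    rw [hinv, hI]
    intro h hh
    have := map_evalMat (algebraMap C K) (RingHom.id C) h.val Q
    rw [hQ h hh, map_zero] at this
    rw [evalMat_map]
    simpa using this.symm
  have hmem := Ideal.mem_of_apply_mem_of_surjective I _ (fun P => ⟨_, hinv P⟩) hle hQI
  have := evalMat_eq_zero_of_mem_pts hb _ ((hI _).mp hmem)
  rw [evalMat_leftMul, evalMat_map] at this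
  simpa using this

end Points

section LinearDifferentialEquation

variable {C k S : Type} [Field C] [Field k] [CommRing S] [Algebra C k] [Algebra C S] [Algebra k S] {n : ℕ}

/-- The derivation of `k[X]` extending `d` with `X ↦ AX`. -/
def matDer (d : Derivation C k k) (A : Matrix (Fin n) (Fin n) k) :
    MvPolynomial (Fin n × Fin n) k →+ MvPolynomial (Fin n × Fin n) k :=
  coeffDer d + (mkDerivation k fun p => leftMul A (X p) :
    Derivation k (MvPolynomial (Fin n × Fin n) k) _).toLinearMap.toAddMonoidHom

theorem matDer_apply (d : Derivation C k k) (A : Matrix (Fin n) (Fin n) k)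
    (P : MvPolynomial (Fin n × Fin n) k) :
    matDer d A P = coeffDer d P + mkDerivation k (fun p => leftMul A (X p)) P :=
  rfl

theorem matDer_C (d : Derivation C k k) (A : Matrix (Fin n) (Fin n) k) (a : k) :
    matDer d A (MvPolynomial.C a) = MvPolynomial.C (d a) := by
  rw [matDer_apply, coeffDer_C, derivation_C, add_zero]

theorem matDer_mul_X (d : Derivation C k k) (A : Matrix (Fin n) (Fin n) k)
    (P : MvPolynomial (Fin n × Fin n) k) (p : Fin n × Fin n) :
    matDer d A (P * X p) = P * leftMul A (X p) + X p * matDer d A P := by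
  rw [matDer_apply, matDer_apply, coeffDer_mul, coeffDer_X, Derivation.leibniz, mkDerivation_X,
    smul_eq_mul, smul_eq_mul]
  ring

theorem totalDegree_matDer_le (d : Derivation C k k) (A : Matrix (Fin n) (Fin n) k)
    (P : MvPolynomial (Fin n × Fin n) k) : (matDer d A P).totalDegree ≤ P.totalDegree := by
  rw [matDer_apply]
  refine (totalDegree_add _ _).trans (max_le (totalDegree_coeffDer_le d P)
    (totalDegree_mkDerivation_le _ (fun p => ?_) P))
  rw [leftMul_X]
  refine totalDegree_finsetSum_le fun l _ => (totalDegree_mul _ _).trans ?_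
  rw [totalDegree_C, zero_add]
  exact (totalDegree_monomial_le _ _).trans (by simp)

variable {d : Derivation C k k} {A : Matrix (Fin n) (Fin n) k} {dS : Derivation C S S}
  {F : Matrix (Fin n) (Fin n) S}

theorem evalMat_matDer (hd : ∀ a, dS (algebraMap k S a) = algebraMap k S (d a))
    (hF : ∀ i j, dS (F i j) = (A.map (algebraMap k S) * F) i j)
    (P : MvPolynomial (Fin n × Fin n) k) :
    evalMat (algebraMap k S) F (matDer d A P) = dS (evalMat (algebraMap k S) F P) := by
  induction P using MvPolynomial.induction_on with
  | C a => rw [matDer_C, evalMat_C, evalMat_C, hd]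
  | add p q hp hq => simp only [map_add, hp, hq]
  | mul_X p i hp =>
    rw [matDer_mul_X, map_add, map_mul, map_mul, hp, map_mul, Derivation.leibniz, evalMat_leftMul,
      evalMat_X, evalMat_X, hF, smul_eq_mul, smul_eq_mul]

theorem leftMul_matDer (hd : ∀ a, dS (algebraMap k S a) = algebraMap k S (d a))
    (hF : ∀ i j, dS (F i j) = (A.map (algebraMap k S) * F) i j)
    (P : MvPolynomial (Fin n × Fin n) k) :
    leftMul F (MvPolynomial.map (algebraMap k S) (matDer d A P)) =
      coeffDer dS (leftMul F (MvPolynomial.map (algebraMap k S) P)) := by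
  induction P using MvPolynomial.induction_on with
  | C a => rw [matDer_C, map_C, map_C, leftMul_C, leftMul_C, coeffDer_C, hd]
  | add p q hp hq => simp only [map_add, hp, hq]
  | mul_X p i hp =>
    have hX : leftMul F (MvPolynomial.map (algebraMap k S) (leftMul A (X i))) =
        coeffDer dS (leftMul F (X i)) := by
      have : MvPolynomial.map (algebraMap k S) (leftMul A (X i)) =
          leftMul (A.map (algebraMap k S)) (X i) := by simp
      rw [this, leftMul_mul, leftMul_X, leftMul_X, map_sum]
      refine Finset.sum_congr rfl fun l _ => ?_
      rw [coeffDer_mul, coeffDer_X, coeffDer_C, hF, mul_zero, zero_add, mul_comm]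
    rw [matDer_mul_X, map_add, map_mul, map_mul, map_add, map_mul, map_mul, hp, hX, map_mul,
      map_mul, map_X, coeffDer_mul]

variable (k) in
/-- The polynomials of total degree at most `ν` vanishing at `F`. -/
def relations (F : Matrix (Fin n) (Fin n) S) (ν : ℕ) : Set (MvPolynomial (Fin n × Fin n) k) :=
  {P | P.totalDegree ≤ ν ∧ evalMat (algebraMap k S) F P = 0}

variable (k) in
/-- The `S`-module spanned by the polynomials `P(FZ)` for `P` a relation of degree at most `ν`. -/
def relationModule (F : Matrix (Fin n) (Fin n) S) (ν : ℕ) :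
    Submodule S (MvPolynomial (Fin n × Fin n) S) :=
  Submodule.span S
    ((fun P => leftMul F (MvPolynomial.map (algebraMap k S) P)) '' relations k F ν)

theorem coeffDer_mem_relationModule (hd : ∀ a, dS (algebraMap k S a) = algebraMap k S (d a))
    (hF : ∀ i j, dS (F i j) = (A.map (algebraMap k S) * F) i j) (ν : ℕ) :
    ∀ f ∈ relationModule k F ν, coeffDer dS f ∈ relationModule k F ν := by
  intro f hf
  induction hf using Submodule.span_induction with
  | mem f hf =>
    obtain ⟨P, hP, rfl⟩ := hf
    refine Submodule.subset_span ⟨matDer d A P, ⟨(totalDegree_matDer_le d A P).trans hP.1, ?_⟩,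
      leftMul_matDer hd hF P⟩
    rw [evalMat_matDer hd hF, hP.2, map_zero]
  | zero => rw [map_zero]; exact Submodule.zero_mem _
  | add f g _ _ hf hg => rw [map_add]; exact Submodule.add_mem _ hf hg
  | smul a f hf' hf =>
    rw [coeffDer_smul]
    exact Submodule.add_mem _ (Submodule.smul_mem _ _ hf) (Submodule.smul_mem _ _ hf')

theorem relationModule_le_span (hd : ∀ a, dS (algebraMap k S a) = algebraMap k S (d a))
    (hF : ∀ i j, dS (F i j) = (A.map (algebraMap k S) * F) i j)
    (hsimple : ∀ J : Ideal S, J ≠ ⊤ → (∀ x ∈ J, dS x ∈ J) → J = ⊥)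
    (hconst : ∀ s : S, dS s = 0 → ∃ c : C, s = algebraMap C S c) (ν : ℕ) :
    relationModule k F ν ≤ Submodule.span S (MvPolynomial.map (algebraMap C S) ''
      {b | MvPolynomial.map (algebraMap C S) b ∈ relationModule k F ν}) := by
  classical
  refine (le_span_constants dS hsimple _ (coeffDer_mem_relationModule hd hF ν)).trans
    (Submodule.span_mono ?_)
  rintro g ⟨hg, hdg⟩
  obtain ⟨b, rfl⟩ := mem_range_map_iff_coeffs_subset (f := algebraMap C S) (x := g) |>.mpr (by
    intro s hs
    obtain ⟨m, hm, rfl⟩ := Finset.mem_image.mp (Finset.mem_coe.mp hs)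
    obtain ⟨c, hc⟩ := hconst (MvPolynomial.coeff m g) (by rw [← coeff_coeffDer, hdg, coeff_zero])
    exact ⟨c, hc.symm⟩)
  exact ⟨b, hg, rfl⟩

theorem evalMat_eq_zero_of_mem_span {L : Type*} [CommRing L] (φ : S →+* L)
    (N : Matrix (Fin n) (Fin n) L) {X : Set (MvPolynomial (Fin n × Fin n) S)}
    (hX : ∀ f ∈ X, evalMat φ N f = 0) {f : MvPolynomial (Fin n × Fin n) S}
    (hf : f ∈ Submodule.span S X) : evalMat φ N f = 0 := by
  induction hf using Submodule.span_induction with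
  | mem f hf => exact hX f hf
  | zero => rw [map_zero]
  | add f g _ _ hf hg => rw [map_add, hf, hg, add_zero]
  | smul a f _ hf => rw [smul_eq_C_mul, map_mul, hf, mul_zero]

theorem evalMat_matX_det {K L : Type} [Field K] [CommRing L] (φ : K →+* L)
    (N : Matrix (Fin n) (Fin n) L) : evalMat φ N (matX K n).det = N.det := by
  rw [RingHom.map_det]
  congr 1
  ext i j
  simp [matX]

/-- Zeros of the relations of degree at most `ν` differ from a specialization of the fundamental
matrix by a point of the group of constant matrices preserving the relations. -/
theorem inv_mul_mem_pts_of_relations [IsAlgClosed C]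
    {K : Type} [Field K] [Algebra C K] [Algebra k K] [IsScalarTower C k K]
    [IsScalarTower C k S]
    (hd : ∀ a, dS (algebraMap k S a) = algebraMap k S (d a))
    (hF : ∀ i j, dS (F i j) = (A.map (algebraMap k S) * F) i j)
    (hsimple : ∀ J : Ideal S, J ≠ ⊤ → (∀ x ∈ J, dS x ∈ J) → J = ⊥)
    (hconst : ∀ s : S, dS s = 0 → ∃ c : C, s = algebraMap C S c) (ν : ℕ)
    (H : Set (GL (Fin n) C))
    (hH : ∀ g : GL (Fin n) C, (∀ P ∈ relations k F ν,
      evalMat (algebraMap k S) (F * g.val.map (algebraMap C S)) P = 0) → g ∈ H)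
    (φ : S →ₐ[k] K) (F₀ α : GL (Fin n) K) (hF₀ : F₀.val = F.map φ)
    (hα : ∀ P ∈ relations k F ν, evalMat (algebraMap k K) α.val P = 0) :
    F₀⁻¹ * α ∈ pts C K n H := by
  have hφk : (φ : S →+* K).comp (algebraMap k S) = algebraMap k K := φ.comp_algebraMap
  have hφC : (φ : S →+* K).comp (algebraMap C S) = algebraMap C K := by
    rw [IsScalarTower.algebraMap_eq C k S, ← RingHom.comp_assoc, hφk,
      ← IsScalarTower.algebraMap_eq]
  let I : Ideal (MvPolynomial (Fin n × Fin n) C) :=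
    Ideal.span {b | MvPolynomial.map (algebraMap C S) b ∈ relationModule k F ν}
  rw [mem_pts_iff]
  intro Q hQ
  have hker : I ≤ RingHom.ker (evalMat (algebraMap C K) (F₀⁻¹ * α).val) := by
    rw [Ideal.span_le]
    intro b hb
    have := evalMat_eq_zero_of_mem_span (φ : S →+* K) (F₀⁻¹ * α).val (by
      rintro _ ⟨P, hP, rfl⟩
      rw [evalMat_leftMul, evalMat_map, hφk]
      change evalMat _ (F.map φ * _) P = 0
      rw [← hF₀, ← Units.val_mul, mul_inv_cancel_left]
      exact hα P hP) hb
    rwa [evalMat_map, hφC] at this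
  have hrad : (matX C n).det * Q ∈ I.radical := by
    rw [← vanishingIdeal_zeroLocus_eq_radical (K := C), mem_vanishingIdeal_iff]
    intro x hx
    let N : Matrix (Fin n) (Fin n) C := Matrix.of fun i j => x (i, j)
    change evalMat (RingHom.id C) N _ = 0
    rw [map_mul, evalMat_matX_det]
    by_cases hN : N.det = 0
    · rw [hN, zero_mul]
    let g : GL (Fin n) C := Matrix.GeneralLinearGroup.mkOfDetNeZero N hN
    have hg : g ∈ H := by
      apply hH
      intro P hP
      have hPm : leftMul F (MvPolynomial.map (algebraMap k S) P) ∈ relationModule k F ν :=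
        Submodule.subset_span ⟨P, hP, rfl⟩
      have := evalMat_eq_zero_of_mem_span (RingHom.id S) (N.map (algebraMap C S)) (by
        rintro _ ⟨b, hb, rfl⟩
        have hbx : evalMat (RingHom.id C) N b = 0 := hx b (Ideal.subset_span hb)
        have h := map_evalMat (algebraMap C S) (RingHom.id C) N b
        rw [hbx, map_zero] at h
        rw [evalMat_map]
        exact h.symm) (relationModule_le_span hd hF hsimple hconst ν hPm)
      rw [evalMat_leftMul, evalMat_map] at this
      exact this
    have : evalMat (RingHom.id C) N Q = 0 := hQ g hg
    rw [this, mul_zero]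
  obtain ⟨m, hm⟩ := hrad
  have h := hker hm
  rw [RingHom.mem_ker, map_pow, map_mul, evalMat_matX_det] at h
  exact (mul_eq_zero.mp (eq_zero_of_pow_eq_zero h)).resolve_left
    (Matrix.GeneralLinearGroup.det (F₀⁻¹ * α)).ne_zero

end LinearDifferentialEquation

section GLRing

variable {k S : Type} [Field k] [CommRing S] [Algebra k S] {n : ℕ}

theorem algHom_algebraMap_eq_evalMat (f : GLRing k n →ₐ[k] S) (F : Matrix (Fin n) (Fin n) S)
    (hf : ∀ i j, f (XX k n i j) = F i j) (P : MvPolynomial (Fin n × Fin n) k) :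
    f (algebraMap _ (GLRing k n) P) = evalMat (algebraMap k S) F P := by
  have : (f.comp (IsScalarTower.toAlgHom k (MvPolynomial (Fin n × Fin n) k) (GLRing k n))) =
      aeval fun p => F p.1 p.2 := by
    refine MvPolynomial.algHom_ext fun p => ?_
    rw [aeval_X, ← hf]
    rfl
  exact DFunLike.congr_fun this P

theorem Ifv_le_ker_iff (ev : GLRing k n →ₐ[k] S) (F : Matrix (Fin n) (Fin n) S)
    (hev : ∀ i j, ev (XX k n i j) = F i j) (ν : ℕ) (J : Ideal (GLRing k n)) :
    Ifv ev ν ≤ J ↔ ∀ P ∈ relations k F ν, algebraMap _ (GLRing k n) P ∈ J := by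
  rw [Ifv, Ideal.span_le]
  constructor
  · rintro h P ⟨hP, hP0⟩
    exact h ⟨P, hP, by rw [algHom_algebraMap_eq_evalMat ev F hev, hP0], rfl⟩
  · rintro h _ ⟨P, hP, hP0, rfl⟩
    rw [algHom_algebraMap_eq_evalMat ev F hev] at hP0
    exact h P ⟨hP, hP0⟩

theorem algHom_GLRing_ext {f g : GLRing k n →ₐ[k] S}
    (h : ∀ i j, f (XX k n i j) = g (XX k n i j)) : f = g := by
  apply AlgHom.coe_ringHom_injective
  apply IsLocalization.ringHom_ext (Submonoid.powers (matX k n).det)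
  refine RingHom.ext fun P => ?_
  change f (algebraMap _ _ P) = g (algebraMap _ _ P)
  rw [algHom_algebraMap_eq_evalMat f ((XX k n).map g) h,
    algHom_algebraMap_eq_evalMat g ((XX k n).map g) fun _ _ => rfl]

end GLRing

theorem exists_algHom_of_finiteType {k S K : Type*} [Field k] [CommRing S] [Nontrivial S]
    [Algebra k S] [Algebra.FiniteType k S] [Field K] [IsAlgClosed K] [Algebra k K] :
    Nonempty (S →ₐ[k] K) := by
  obtain ⟨m, hm⟩ := Ideal.exists_maximal S
  let := Ideal.Quotient.field m
  have : Algebra.FiniteType k (S ⧸ m) :=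
    Algebra.FiniteType.of_surjective (Ideal.Quotient.mkₐ k m) (Ideal.Quotient.mkₐ_surjective k m)
  have : Module.Finite k (S ⧸ m) := finite_of_finite_type_of_isJacobsonRing k (S ⧸ m)
  exact ⟨(IsAlgClosed.lift : (S ⧸ m) →ₐ[k] K).comp (Ideal.Quotient.mkₐ k m)⟩

theorem statement5
    (C : Type) [Field C] [IsAlgClosed C] [CharZero C]
    (n : ℕ)
    -- the derivation δ = d/dt on k = C(t)
    (dk : Derivation C (RatFunc C) (RatFunc C)) (hdk : dk RatFunc.X = 1)
    (A : Matrix (Fin n) (Fin n) (RatFunc C))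
    -- the derivation on k[X,1/det(X)] extending δ with δ(X) = AX
    (dR : Derivation C (GLRing (RatFunc C) n) (GLRing (RatFunc C) n))
    (hdRk : ∀ a : RatFunc C, dR (algebraMap (RatFunc C) (GLRing (RatFunc C) n) a)
      = algebraMap (RatFunc C) (GLRing (RatFunc C) n) (dk a))
    (hdRX : ∀ i j, dR (XX (RatFunc C) n i j)
      = (A.map (algebraMap (RatFunc C) (GLRing (RatFunc C) n)) * XX (RatFunc C) n) i j)
    -- the Picard-Vessiot ring S of δ(Y) = AY over k, with fundamental matrix F
    (S : Type) [CommRing S] [Nontrivial S] [Algebra (RatFunc C) S] [Algebra C S]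
    [IsScalarTower C (RatFunc C) S]
    (dS : Derivation C S S)
    (hdSk : ∀ a : RatFunc C, dS (algebraMap (RatFunc C) S a) = algebraMap (RatFunc C) S (dk a))
    (F : Matrix (Fin n) (Fin n) S) (hF : IsUnit F.det)
    (hdF : ∀ i j, dS (F i j) = (A.map (algebraMap (RatFunc C) S) * F) i j)
    -- evaluation P(X) ↦ P(F)
    (ev : GLRing (RatFunc C) n →ₐ[RatFunc C] S)
    (hev : ∀ i j, ev (XX (RatFunc C) n i j) = F i j)
    (hevsurj : Function.Surjective ev)      -- S is generated by the entries of F and 1/det(F)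
    (hsimple : ∀ J : Ideal S, J ≠ ⊤ → (∀ x ∈ J, dS x ∈ J) → J = ⊥)  -- S is δ-simple
    (hconst : ∀ s : S, dS s = 0 → ∃ c : C, s = algebraMap C S c)   -- constants of S are C
    -- the substitution maps P(X) ↦ P(Xg) for g ∈ GL_n(C)
    (subst : GL (Fin n) C → (GLRing (RatFunc C) n →ₐ[RatFunc C] GLRing (RatFunc C) n))
    (hsubst : ∀ (g : GL (Fin n) C) i j, subst g (XX (RatFunc C) n i j)
      = ∑ l, XX (RatFunc C) n i l *
          algebraMap C (GLRing (RatFunc C) n) ((g : Matrix (Fin n) (Fin n) C) l j))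
    -- evaluation maps P(X) ↦ P(M) for M ∈ GL_n(k̄)
    (evK : GL (Fin n) (AlgebraicClosure (RatFunc C)) →
      (GLRing (RatFunc C) n →ₐ[RatFunc C] AlgebraicClosure (RatFunc C)))
    (hevK : ∀ (M : GL (Fin n) (AlgebraicClosure (RatFunc C))) i j,
      evK M (XX (RatFunc C) n i j)
        = (M : Matrix (Fin n) (Fin n) (AlgebraicClosure (RatFunc C))) i j)
    (ν : ℕ) :
    -- V_{k̄}(I(F,ν)) is an H-torsor over k, H = stab(I(F,ν)):
    -- it is nonempty and equals α·H(k̄) for every (hence some) α in it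
    (∃ α, α ∈ zeroSet (fun M => (evK M : GLRing (RatFunc C) n → AlgebraicClosure (RatFunc C)))
        (Ifv (⇑ev) ν))
    ∧ ∀ α ∈ zeroSet (fun M => (evK M : GLRing (RatFunc C) n → AlgebraicClosure (RatFunc C)))
        (Ifv (⇑ev) ν),
      zeroSet (fun M => (evK M : GLRing (RatFunc C) n → AlgebraicClosure (RatFunc C)))
          (Ifv (⇑ev) ν)
        = (fun h => α * h) '' pts C (AlgebraicClosure (RatFunc C)) n
            (stab (fun g => (subst g : GLRing (RatFunc C) n → GLRing (RatFunc C) n))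
              (Ifv (⇑ev) ν)) := by
  set K := AlgebraicClosure (RatFunc C)
  have hzero : ∀ α : GL (Fin n) K, α ∈ zeroSet (fun M => (evK M : GLRing (RatFunc C) n → K))
      (Ifv ev ν) ↔ ∀ P ∈ relations (RatFunc C) F ν,
        evalMat (algebraMap (RatFunc C) K) α.val P = 0 := by
    intro α
    have h := Ifv_le_ker_iff ev F hev ν (RingHom.ker (evK α))
    simp only [RingHom.mem_ker, algHom_algebraMap_eq_evalMat (evK α) α.val (hevK α)] at h
    exact h
  have hsubst' : ∀ (g : GL (Fin n) C) (P : MvPolynomial (Fin n × Fin n) (RatFunc C)),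
      subst g (algebraMap _ (GLRing (RatFunc C) n) P) =
        algebraMap _ _ (rightMul (g.val.map (algebraMap C (RatFunc C))) P) := by
    intro g P
    induction P using MvPolynomial.induction_on with
    | C a =>
      rw [rightMul_C]
      exact (subst g).commutes a
    | add p q hp hq => simp only [map_add, hp, hq]
    | mul_X p i hp =>
      rw [map_mul, map_mul, hp, map_mul, map_mul, rightMul_X, map_sum]
      congr 1
      refine (hsubst g i.1 i.2).trans (Finset.sum_congr rfl fun l _ => ?_)
      rw [map_mul]
      rfl
  have hstab : ∀ g : GL (Fin n) C, g ∈ stab (fun g => (subst g : GLRing (RatFunc C) n → _))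
      (Ifv ev ν) ↔ ∀ P ∈ relations (RatFunc C) F ν,
        algebraMap _ _ (rightMul (g.val.map (algebraMap C (RatFunc C))) P) ∈ Ifv ev ν := by
    intro g
    have h := Ifv_le_ker_iff ev F hev ν ((Ifv ev ν).comap (subst g))
    simp only [Ideal.mem_comap, hsubst'] at h
    exact h
  set H := stab (fun g => (subst g : GLRing (RatFunc C) n → GLRing (RatFunc C) n)) (Ifv ev ν)
  have hH : ∀ g : GL (Fin n) C, (∀ P ∈ relations (RatFunc C) F ν,
      evalMat (algebraMap (RatFunc C) S) (F * g.val.map (algebraMap C S)) P = 0) → g ∈ H := by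
    intro g hg
    rw [hstab]
    intro P hP
    refine Ideal.subset_span ⟨_, (totalDegree_rightMul_le _ P).trans hP.1, ?_, rfl⟩
    rw [algHom_algebraMap_eq_evalMat ev F hev, evalMat_rightMul, Matrix.map_map]
    have := hg P hP
    rwa [IsScalarTower.algebraMap_eq C (RatFunc C) S] at this
  have hmul : ∀ g ∈ H, ∀ h ∈ H, g * h ∈ H := by
    intro g hg h hh P hP
    have hcomp : ∀ Q, subst (g * h) Q = subst g (subst h Q) := by
      have : subst (g * h) = (subst g).comp (subst h) := by
        apply algHom_GLRing_ext
        intro i j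
        have hC : ∀ c : C, subst g (algebraMap C (GLRing (RatFunc C) n) c) = algebraMap C _ c := by
          intro c
          rw [IsScalarTower.algebraMap_apply C (RatFunc C) (GLRing (RatFunc C) n), AlgHom.commutes]
        rw [AlgHom.comp_apply, hsubst, hsubst, map_sum]
        simp only [map_mul, hsubst, hC, Units.val_mul, Matrix.mul_apply, map_sum, Finset.sum_mul,
          Finset.mul_sum]
        rw [Finset.sum_comm]
        simp only [mul_assoc]
      exact fun Q => DFunLike.congr_fun this Q
    change subst (g * h) P ∈ _
    rw [hcomp]
    exact hg _ (hh P hP)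
  have : Algebra.FiniteType (RatFunc C) (GLRing (RatFunc C) n) :=
    Algebra.FiniteType.trans (S := MvPolynomial (Fin n × Fin n) (RatFunc C)) inferInstance
      (IsLocalization.finiteType_of_monoid_fg
        (Submonoid.powers (matX (RatFunc C) n).det) _)
  have : Algebra.FiniteType (RatFunc C) S := Algebra.FiniteType.of_surjective ev hevsurj
  obtain ⟨φ⟩ := exists_algHom_of_finiteType (k := RatFunc C) (S := S) (K := K)
  have hdet : (F.map φ).det ≠ 0 := by
    have := (hF.map φ).ne_zero
    rwa [AlgHom.map_det] at this
  let F₀ : GL (Fin n) K := Matrix.GeneralLinearGroup.mkOfDetNeZero (F.map φ) hdet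
  have hpts : ∀ α : GL (Fin n) K, (∀ P ∈ relations (RatFunc C) F ν,
      evalMat (algebraMap (RatFunc C) K) α.val P = 0) → F₀⁻¹ * α ∈ pts C K n H := fun α hα =>
    inv_mul_mem_pts_of_relations hdSk hdF hsimple hconst ν H hH φ F₀ α rfl hα
  refine ⟨⟨F₀, (hzero _).mpr fun P hP => ?_⟩, fun α hα => Set.ext fun β => ⟨fun hβ => ?_, ?_⟩⟩
  · have := map_evalMat (φ : S →+* K) (algebraMap (RatFunc C) S) F P
    rw [hP.2, map_zero, φ.comp_algebraMap] at this
    exact this.symm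
  · refine ⟨α⁻¹ * β, ?_, mul_inv_cancel_left α β⟩
    have := inv_mul_mem_pts hmul (hpts α ((hzero α).mp hα)) (hpts β ((hzero β).mp hβ))
    rwa [_root_.mul_inv_rev, inv_inv, mul_assoc, mul_inv_cancel_left] at this
  · rintro ⟨h, hh, rfl⟩
    rw [hzero]
    intro P hP
    have := evalMat_eq_zero_of_mem_pts hh
      (leftMul α.val (MvPolynomial.map (algebraMap (RatFunc C) K) P)) (by
        intro g hg
        have hg' := hα _ ((hstab g).mp hg P hP)
        change evK α _ = 0 at hg'
        rw [algHom_algebraMap_eq_evalMat (evK α) α.val (hevK α), evalMat_rightMul] at hg'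
        rw [evalMat_leftMul, evalMat_map]
        rw [Matrix.map_map] at hg'
        rw [IsScalarTower.algebraMap_eq C (RatFunc C) K]
        simpa using hg')
    rw [evalMat_leftMul, evalMat_map] at this
    simpa using this
end
end

section
/- Let Ī be a maximal δ-ideal of k̄[X,1/det(X)] generated by a finite set S, let k̃ be a finite Galois extension of k with S ⊆ k̃[X,1/det(X)], and let {ρ₁(S),…,ρ_d(S)} be the orbit of S under Gal(k̃/k) (acting on coefficients). Then 𝔪 = k[X,1/det(X)] ∩ ⋂_{i=1}^d ⟨ρ_i(S)⟩_{k̃} is a maximal δ-ideal of k[X,1/det(X)]. -/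
open MvPolynomial Matrix

noncomputable section

/-- The algebraic closure k̄ of k = C(t). -/
abbrev kbar (C : Type) [Field C] : Type := AlgebraicClosure (RatFunc C)

/-- `I` is a δ-ideal: δ(I) ⊆ I. -/
def IsDiffIdeal {R : Type} [CommRing R] (δ : R → R) (I : Ideal R) : Prop := ∀ x ∈ I, δ x ∈ I

/-- `I` is a maximal δ-ideal: a proper δ-ideal maximal among proper δ-ideals. -/
def IsMaxDiffIdeal {R : Type} [CommRing R] (δ : R → R) (I : Ideal R) : Prop :=
  I ≠ ⊤ ∧ IsDiffIdeal δ I ∧ ∀ J : Ideal R, J ≠ ⊤ → IsDiffIdeal δ J → I ≤ J → J = I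

section GLRingLemmas

variable {K L : Type} [Field K] [Field L] {n : ℕ}

lemma GLRing.algebraMap_matX_det :
    algebraMap _ (GLRing K n) (matX K n).det = (XX K n).det := by
  rw [RingHom.map_det]
  rfl

lemma GLRing.induction {P : GLRing K n → Prop}
    (hC : ∀ a : K, P (algebraMap K _ a)) (hX : ∀ i j, P (XX K n i j))
    (hadd : ∀ x y, P x → P y → P (x + y)) (hmul : ∀ x y, P x → P y → P (x * y))
    (hinv : P (XX K n).det → ∀ u : GLRing K n, u * (XX K n).det = 1 → P u) (x : GLRing K n) :
    P x := by
  have hpoly : ∀ p, P (algebraMap (MvPolynomial (Fin n × Fin n) K) (GLRing K n) p) := by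
    intro p
    induction p using MvPolynomial.induction_on with
    | C a => exact hC a
    | add p q hp hq => rw [map_add]; exact hadd _ _ hp hq
    | mul_X p i hp => rw [map_mul]; exact hmul _ _ hp (hX i.1 i.2)
  obtain ⟨⟨p, ⟨_, m, rfl⟩⟩, h⟩ := IsLocalization.surj (Submonoid.powers (matX K n).det) x
  obtain ⟨u, hu⟩ := (IsLocalization.Away.algebraMap_isUnit
    (S := GLRing K n) (matX K n).det).exists_left_inv
  rw [GLRing.algebraMap_matX_det] at hu
  have hPu : P u := by
    refine hinv ?_ u hu
    rw [← GLRing.algebraMap_matX_det]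
    exact hpoly _
  have hPpow : P (u ^ m) := by
    clear h
    induction m with
    | zero => simpa using hC 1
    | succ m ih => rw [pow_succ]; exact hmul _ _ ih hPu
  have hx : x = algebraMap _ _ p * u ^ m := by
    rw [← h]
    simp only [map_pow, GLRing.algebraMap_matX_det]
    rw [mul_assoc, ← mul_pow, mul_comm _ u, hu, one_pow, mul_one]
  rw [hx]
  exact hmul _ _ (hpoly p) hPpow

lemma GLRing.map_XX_det (f : GLRing K n →+* GLRing L n)
    (hfX : ∀ i j, f (XX K n i j) = XX L n i j) : f (XX K n).det = (XX L n).det := by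
  rw [RingHom.map_det]
  congr 1
  ext i j
  exact hfX i j

lemma GLRing.ringHom_isIntegral [Algebra K L] [Algebra.IsAlgebraic K L]
    (f : GLRing K n →+* GLRing L n) (hfX : ∀ i j, f (XX K n i j) = XX L n i j)
    (hfc : ∀ a : K, f (algebraMap K _ a) = algebraMap L _ (algebraMap K L a)) :
    f.IsIntegral := by
  intro y
  induction y using GLRing.induction with
  | hC a =>
    obtain ⟨p, hp, hpa⟩ := Algebra.IsIntegral.isIntegral (R := K) a
    refine ⟨p.map (algebraMap K _), hp.map _, ?_⟩
    have hc : f.comp (algebraMap K _) = (algebraMap L (GLRing L n)).comp (algebraMap K L) :=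
      RingHom.ext hfc
    rw [Polynomial.eval₂_map, hc, ← Polynomial.hom_eval₂, hpa, map_zero]
  | hX i j => rw [← hfX]; exact f.isIntegralElem_map
  | hadd x y hx hy => exact hx.add f hy
  | hmul x y hx hy => exact hx.mul f hy
  | hinv _ u hu =>
    obtain ⟨v, hv⟩ := (IsLocalization.Away.algebraMap_isUnit
      (S := GLRing K n) (matX K n).det).exists_left_inv
    rw [GLRing.algebraMap_matX_det] at hv
    have hfv : f v * (XX L n).det = 1 := by
      rw [← GLRing.map_XX_det f hfX, ← map_mul, hv, map_one]
    have : u = f v := by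
      calc u = u * (f v * (XX L n).det) := by rw [hfv, mul_one]
        _ = f v * (u * (XX L n).det) := by ring
        _ = f v := by rw [hu, mul_one]
    rw [this]
    exact f.isIntegralElem_map

/-- A ring homomorphism commuting with derivations on generators commutes with them. -/
lemma GLRing.map_derivation {C : Type} [Field C]
    [Algebra C (GLRing K n)] [Algebra C (GLRing L n)]
    (f : GLRing K n →+* GLRing L n)
    (d : Derivation C (GLRing K n) (GLRing K n)) (D : Derivation C (GLRing L n) (GLRing L n))
    (hc : ∀ a : K, D (f (algebraMap K _ a)) = f (d (algebraMap K _ a)))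
    (hX : ∀ i j, D (f (XX K n i j)) = f (d (XX K n i j))) (x : GLRing K n) :
    D (f x) = f (d x) := by
  induction x using GLRing.induction with
  | hC a => exact hc a
  | hX i j => exact hX i j
  | hadd x y hx hy => simp only [map_add, hx, hy]
  | hmul x y hx hy =>
    simp only [map_mul, Derivation.leibniz, map_add, smul_eq_mul, hx, hy]
  | hinv hdet u hu =>
    have h1 := congrArg D (congrArg f hu)
    have h2 := congrArg f (congrArg d hu)
    have h3 := congrArg f hu
    simp only [map_mul, map_one, Derivation.leibniz, map_add, smul_eq_mul, hdet,
      Derivation.map_one_eq_zero, map_zero] at h1 h2 h3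
    linear_combination (f u) * (h1 - h2) - (D (f u) - f (d u)) * h3

lemma MvPolynomial.comap_map_map [Algebra K L] {σ : Type} (I : Ideal (MvPolynomial σ K)) :
    (I.map (MvPolynomial.map (algebraMap K L))).comap (MvPolynomial.map (algebraMap K L)) = I := by
  let : Algebra (MvPolynomial σ K) (MvPolynomial σ L) := MvPolynomial.algebraMvPolynomial
  have hb : IsBaseChange (MvPolynomial σ K)
      (IsScalarTower.toAlgHom K L (MvPolynomial σ L)).toLinearMap :=
    (inferInstance : Algebra.IsPushout K (MvPolynomial σ K) L (MvPolynomial σ L)).out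
  have : Module.Free (MvPolynomial σ K) (MvPolynomial σ L) := hb.free
  exact Ideal.comap_map_eq_self_of_faithfullyFlat (B := MvPolynomial σ L) I

lemma GLRing.comap_map [Algebra K L] (f : GLRing K n →+* GLRing L n)
    (hfX : ∀ i j, f (XX K n i j) = XX L n i j)
    (hfc : ∀ a : K, f (algebraMap K _ a) = algebraMap L _ (algebraMap K L a))
    (I : Ideal (GLRing K n)) : (I.map f).comap f = I := by
  refine le_antisymm (fun x hx => ?_) Ideal.le_comap_map
  rw [Ideal.mem_comap] at hx
  let φ := MvPolynomial.map (σ := Fin n × Fin n) (algebraMap K L)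
  have hcomp : f.comp (algebraMap (MvPolynomial (Fin n × Fin n) K) (GLRing K n)) =
      (algebraMap (MvPolynomial (Fin n × Fin n) L) (GLRing L n)).comp φ := by
    refine MvPolynomial.ringHom_ext (fun a => ?_) (fun i => ?_)
    · simp only [φ, RingHom.comp_apply, MvPolynomial.map_C]
      exact hfc a
    · simp only [φ, RingHom.comp_apply, MvPolynomial.map_X]
      exact hfX i.1 i.2
  have hdet : φ (matX K n).det = (matX L n).det := by
    rw [RingHom.map_det]
    congr 1
    ext1 i j
    simp [φ, matX]
  obtain ⟨⟨p, s⟩, h⟩ := IsLocalization.surj (Submonoid.powers (matX K n).det) x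
  set I₀ := I.comap (algebraMap (MvPolynomial (Fin n × Fin n) K) (GLRing K n)) with hI₀
  have hI : I = I₀.map (algebraMap _ _) :=
    (IsLocalization.map_under (Submonoid.powers (matX K n).det) (GLRing K n) I).symm
  have hmap : I.map f = (I₀.map φ).map (algebraMap _ (GLRing L n)) := by
    rw [hI, Ideal.map_map, Ideal.map_map, hcomp]
  have hp : algebraMap _ (GLRing L n) (φ p) ∈ (I₀.map φ).map (algebraMap _ (GLRing L n)) := by
    rw [← hmap, ← RingHom.comp_apply, ← hcomp, RingHom.comp_apply, ← h, map_mul]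
    exact Ideal.mul_mem_right _ _ hx
  rw [IsLocalization.algebraMap_mem_map_algebraMap_iff (Submonoid.powers (matX L n).det)] at hp
  obtain ⟨_, ⟨m, rfl⟩, hm⟩ := hp
  have hm' : (matX K n).det ^ m * p ∈ (I₀.map φ).comap φ := by
    rw [Ideal.mem_comap, map_mul, map_pow, hdet]
    exact hm
  rw [MvPolynomial.comap_map_map, hI₀, Ideal.mem_comap, map_mul, map_pow] at hm'
  have hu := IsLocalization.Away.algebraMap_isUnit (S := GLRing K n) (matX K n).det
  rw [Ideal.unit_mul_mem_iff_mem _ (hu.pow m), ← h, mul_comm,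
    Ideal.unit_mul_mem_iff_mem _ (IsLocalization.map_units _ s)] at hm'
  exact hm'

lemma GLRing.ringHom_ext {R : Type} [CommRing R] {f g : GLRing K n →+* R}
    (hc : ∀ a : K, f (algebraMap K _ a) = g (algebraMap K _ a))
    (hX : ∀ i j, f (XX K n i j) = g (XX K n i j)) : f = g :=
  IsLocalization.ringHom_ext (Submonoid.powers (matX K n).det)
    (MvPolynomial.ringHom_ext (fun a => hc a) (fun i => hX i.1 i.2))

end GLRingLemmas

/-- The contraction of a maximal δ-ideal along an integral differential homomorphism is a
maximal δ-ideal. -/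
lemma IsMaxDiffIdeal.comap {R S : Type} [CommRing R] [CommRing S] {d : R → R} {D : S → S}
    (f : R →+* S) (hf : f.IsIntegral) (hfD : ∀ x, D (f x) = f (d x))
    (hDadd : ∀ x y, D (x + y) = D x + D y) (hDmul : ∀ x y, D (x * y) = x * D y + y * D x)
    {I : Ideal S} (hI : IsMaxDiffIdeal D I) : IsMaxDiffIdeal d (I.comap f) := by
  obtain ⟨hne, hdiff, hmax⟩ := hI
  refine ⟨Ideal.comap_ne_top f hne, fun x hx => ?_, fun J hJ hJd hIJ => ?_⟩
  · rw [Ideal.mem_comap, ← hfD]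
    exact hdiff _ hx
  · refine le_antisymm (Ideal.map_le_iff_le_comap.mp ?_) hIJ
    obtain ⟨M, hM, hJM⟩ := Ideal.exists_le_maximal J hJ
    algebraize [f]
    obtain ⟨Q, hIQ, hQ, hQM⟩ :=
      Ideal.exists_ideal_over_prime_of_isIntegral M I (hIJ.trans hJM)
    have hJQ : J.map f ≤ Q := Ideal.map_le_iff_le_comap.mpr (hJM.trans hQM.ge)
    have hJmap : IsDiffIdeal D (J.map f) := by
      intro x hx
      induction hx using Submodule.span_induction with
      | mem x hx =>
        obtain ⟨y, hy, rfl⟩ := hx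
        rw [hfD]
        exact Ideal.mem_map_of_mem f (hJd y hy)
      | zero =>
        have h0 : D 0 = 0 := by simpa using hDadd 0 0
        rw [h0]
        exact zero_mem _
      | add x y _ _ hx hy => rw [hDadd]; exact add_mem hx hy
      | smul a x hx' hx =>
        rw [smul_eq_mul, hDmul]
        exact add_mem (Ideal.mul_mem_left _ _ hx) (Ideal.mul_mem_right _ _ hx')
    have hsup := hmax (I ⊔ J.map f) (ne_top_of_le_ne_top hQ.ne_top (sup_le hIQ hJQ))
      (fun x hx => by
        obtain ⟨y, hy, z, hz, rfl⟩ := Submodule.mem_sup.mp hx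
        rw [hDadd]
        exact add_mem (Ideal.mem_sup_left (hdiff y hy)) (Ideal.mem_sup_right (hJmap z hz)))
      le_sup_left
    exact le_sup_right.trans hsup.le

set_option synthInstance.maxHeartbeats 1000000
set_option maxHeartbeats 4000000

theorem statement14
    (C : Type) [Field C] [IsAlgClosed C] [CharZero C]
    (n : ℕ)
    -- the derivation δ = d/dt on k = C(t)
    (dk : Derivation C (RatFunc C) (RatFunc C)) (hdk : dk RatFunc.X = 1)
    (A : Matrix (Fin n) (Fin n) (RatFunc C))
    -- the derivation on k[X,1/det(X)] extending δ with δ(X) = AX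
    (dR : Derivation C (GLRing (RatFunc C) n) (GLRing (RatFunc C) n))
    (hdRk : ∀ a : RatFunc C, dR (algebraMap (RatFunc C) (GLRing (RatFunc C) n) a)
      = algebraMap (RatFunc C) (GLRing (RatFunc C) n) (dk a))
    (hdRX : ∀ i j, dR (XX (RatFunc C) n i j)
      = (A.map (algebraMap (RatFunc C) (GLRing (RatFunc C) n)) * XX (RatFunc C) n) i j)
    -- the derivation on k̄ extending δ
    (dkb : Derivation C (kbar C) (kbar C))
    (hdkb : ∀ a : RatFunc C, dkb (algebraMap (RatFunc C) (kbar C) a)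
      = algebraMap (RatFunc C) (kbar C) (dk a))
    -- the derivation on k̄[X,1/det(X)] with δ(X) = AX
    (dGb : Derivation C (GLRing (kbar C) n) (GLRing (kbar C) n))
    (hdGbc : ∀ a : kbar C, dGb (algebraMap (kbar C) (GLRing (kbar C) n) a)
      = algebraMap (kbar C) (GLRing (kbar C) n) (dkb a))
    (hdGbX : ∀ i j, dGb (XX (kbar C) n i j)
      = ((A.map (fun a => algebraMap (kbar C) (GLRing (kbar C) n)
          (algebraMap (RatFunc C) (kbar C) a))) * XX (kbar C) n) i j)
    -- k̃ : a finite Galois extension of k inside k̄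
    (kt : IntermediateField (RatFunc C) (kbar C))
    [FiniteDimensional (RatFunc C) ↥kt] [IsGalois (RatFunc C) ↥kt]
    -- the action of Gal(k̃/k) on k̃[X,1/det(X)] through the coefficients
    (act : (↥kt ≃ₐ[RatFunc C] ↥kt) → (GLRing (↥kt) n →+* GLRing (↥kt) n))
    (hactX : ∀ ρ i j, act ρ (XX (↥kt) n i j) = XX (↥kt) n i j)
    (hactc : ∀ ρ (a : ↥kt), act ρ (algebraMap (↥kt) (GLRing (↥kt) n) a)
      = algebraMap (↥kt) (GLRing (↥kt) n) (ρ a))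
    -- the inclusion k[X,1/det(X)] → k̃[X,1/det(X)]
    (ι : GLRing (RatFunc C) n →+* GLRing (↥kt) n)
    (hιX : ∀ i j, ι (XX (RatFunc C) n i j) = XX (↥kt) n i j)
    (hιc : ∀ a : RatFunc C, ι (algebraMap (RatFunc C) (GLRing (RatFunc C) n) a)
      = algebraMap (↥kt) (GLRing (↥kt) n) (algebraMap (RatFunc C) (↥kt) a))
    -- the inclusion k̃[X,1/det(X)] → k̄[X,1/det(X)]
    (ιb : GLRing (↥kt) n →+* GLRing (kbar C) n)
    (hιbX : ∀ i j, ιb (XX (↥kt) n i j) = XX (kbar C) n i j)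
    (hιbc : ∀ a : ↥kt, ιb (algebraMap (↥kt) (GLRing (↥kt) n) a)
      = algebraMap (kbar C) (GLRing (kbar C) n) (a : kbar C))
    -- S : a finite set of elements of k̃[X,1/det(X)] generating a maximal δ-ideal Ī
    -- of k̄[X,1/det(X)]
    (S : Finset (GLRing (↥kt) n))
    (hImax : IsMaxDiffIdeal (fun x => dGb x)
      (Ideal.span (ιb '' (S : Set (GLRing (↥kt) n))))) :
    -- 𝔪 = k[X,1/det(X)] ∩ ⋂_{ρ ∈ Gal(k̃/k)} ⟨ρ(S)⟩_{k̃} is a maximal δ-ideal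
    IsMaxDiffIdeal (fun x => dR x)
      (Ideal.comap ι (⨅ ρ : ↥kt ≃ₐ[RatFunc C] ↥kt,
        Ideal.span (act ρ '' (S : Set (GLRing (↥kt) n))))) := by
  have hfX : ∀ i j, (ιb.comp ι) (XX (RatFunc C) n i j) = XX (kbar C) n i j := fun i j => by
    rw [RingHom.comp_apply, hιX, hιbX]
  have hfc : ∀ a : RatFunc C, (ιb.comp ι) (algebraMap (RatFunc C) _ a)
      = algebraMap (kbar C) _ (algebraMap (RatFunc C) (kbar C) a) := fun a => by
    rw [RingHom.comp_apply, hιc, hιbc]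
    rfl
  have hactι : ∀ ρ x, act ρ (ι x) = ι x := by
    intro ρ x
    refine RingHom.congr_fun (f := (act ρ).comp ι) (GLRing.ringHom_ext (fun a => ?_)
      (fun i j => ?_)) x
    · rw [RingHom.comp_apply, hιc, hactc, ρ.commutes]
    · rw [RingHom.comp_apply, hιX, hactX]
  have hact1 : act 1 = RingHom.id _ :=
    GLRing.ringHom_ext (fun a => by rw [hactc]; rfl) (fun i j => by rw [hactX]; rfl)
  have hcomap := GLRing.comap_map ιb hιbX hιbc (Ideal.span (S : Set (GLRing (↥kt) n)))
  have hm : Ideal.comap ι (⨅ ρ : ↥kt ≃ₐ[RatFunc C] ↥kt,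
        Ideal.span (act ρ '' (S : Set (GLRing (↥kt) n))))
      = (Ideal.span (ιb '' (S : Set (GLRing (↥kt) n)))).comap (ιb.comp ι) := by
    rw [← Ideal.comap_comap, ← Ideal.map_span, hcomap]
    ext x
    rw [Ideal.mem_comap, Ideal.mem_comap, Ideal.mem_iInf]
    refine ⟨fun h => ?_, fun h ρ => ?_⟩
    · simpa [hact1] using h 1
    · rw [← hactι ρ x, ← Ideal.map_span]
      exact Ideal.mem_map_of_mem _ h
  rw [hm]
  refine IsMaxDiffIdeal.comap (ιb.comp ι) (GLRing.ringHom_isIntegral _ hfX hfc)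
    (fun x => ?_) (fun x y => map_add dGb x y) (fun x y => dGb.leibniz x y) hImax
  refine GLRing.map_derivation (ιb.comp ι) dR dGb (fun a => ?_) (fun i j => ?_) x
  · rw [hfc, hdGbc, hdkb, hdRk, hfc]
  · rw [hfX, hdGbX, hdRX, Matrix.mul_apply, Matrix.mul_apply, map_sum]
    refine Finset.sum_congr rfl fun l _ => ?_
    rw [map_mul, hfX, Matrix.map_apply, Matrix.map_apply, hfc]
end
end
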